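/- Let V be a finite set, let k ≥ 1 be an integer, and let L be a finite set. For each l ∈ L let qsupp(l) be a nonempty subset of V × {1, …, k} with |qsupp(l)| ≤ 2, and let bsupp(l) ⊆ V be the image of qsupp(l) under the projection V × {1, …, k} → V. Assume the sets qsupp(l), for l ∈ L, are pairwise disjoint. Then there exists a partition of L into at most 2k − 1 parts such that for any two distinct l, l' lying in the same part, bsupp(l) ∩ bsupp(l') = ∅. -/

import Mathlib

/-- Greedy coloring: a finite graph all of whose degrees are less than `n` is `n`-colorable. -/
theorem SimpleGraph.colorable_of_degree_lt {α : Type*} [Fintype α] [DecidableEq α]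
    (G : SimpleGraph α) [DecidableRel G.Adj] {n : ℕ} (hn : 0 < n)
    (hdeg : ∀ a, G.degree a < n) : G.Colorable n := by
  suffices h : ∀ S : Finset α, ∃ f : α → Fin n, ∀ a ∈ S, ∀ b ∈ S, G.Adj a b → f a ≠ f b by
    obtain ⟨f, hf⟩ := h Finset.univ
    exact ⟨SimpleGraph.Coloring.mk f fun {a b} hab ↦
      hf a (Finset.mem_univ a) b (Finset.mem_univ b) hab⟩
  intro S
  induction S using Finset.induction_on with
  | empty => exact ⟨fun _ ↦ ⟨0, hn⟩, by simp⟩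
  | insert a S ha ih =>
    obtain ⟨f, hf⟩ := ih
    have hlt : ((G.neighborFinset a).image f).card < (Finset.univ : Finset (Fin n)).card := by
      rw [Finset.card_univ, Fintype.card_fin]
      exact Finset.card_image_le.trans_lt (hdeg a)
    obtain ⟨c, -, hc⟩ := Finset.exists_mem_notMem_of_card_lt_card hlt
    have hc' : ∀ b, G.Adj a b → f b ≠ c := fun b hab hb ↦
      hc (Finset.mem_image.2 ⟨b, (G.mem_neighborFinset a b).2 hab, hb⟩)
    refine ⟨Function.update f a c, fun x hx y hy hxy ↦ ?_⟩
    rcases eq_or_ne x a with rfl | hxa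
    · rw [Function.update_self, Function.update_of_ne hxy.ne']
      exact (hc' y hxy).symm
    · rw [Function.update_of_ne hxa]
      rcases eq_or_ne y a with rfl | hya
      · rw [Function.update_self]
        exact hc' x hxy.symm
      · rw [Function.update_of_ne hya]
        exact hf x (Finset.mem_of_mem_insert_of_ne hx hxa) y
          (Finset.mem_of_mem_insert_of_ne hy hya) hxy

/-- Given pairwise disjoint sets in `V × κ`, the sets in a family `T` other than `A l` whose
projections to `V` meet that of `A l` can be charged to distinct points of the fibers over the
projection of `A l`, outside `A l` itself. -/
theorem card_add_card_le_of_not_disjoint_image_fst {V κ L : Type*} [DecidableEq V]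
    [DecidableEq κ] [Fintype κ] (A : L → Finset (V × κ))
    (hdisj : ∀ l l', l ≠ l' → Disjoint (A l) (A l')) (l : L) (T : Finset L)
    (hT : ∀ l' ∈ T, l ≠ l' ∧ ¬ Disjoint ((A l).image Prod.fst) ((A l').image Prod.fst)) :
    T.card + (A l).card ≤ ((A l).image Prod.fst).card * Fintype.card κ := by
  have hsub : A l ⊆ (A l).image Prod.fst ×ˢ Finset.univ := fun p hp ↦
    Finset.mem_product.2 ⟨Finset.mem_image_of_mem _ hp, Finset.mem_univ _⟩
  have hle : T.card ≤ (((A l).image Prod.fst ×ˢ Finset.univ) \ A l).card := by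
    refine Finset.card_le_card_of_forall_subsingleton (fun l' p ↦ p ∈ A l')
      (fun l' hl' ↦ ?_) fun p _ x hx y hy ↦ ?_
    · obtain ⟨v, hv, hv'⟩ := Finset.not_disjoint_iff.1 (hT l' hl').2
      obtain ⟨p, hp, rfl⟩ := Finset.mem_image.1 hv'
      exact ⟨p, Finset.mem_sdiff.2 ⟨Finset.mem_product.2 ⟨hv, Finset.mem_univ _⟩,
        Finset.disjoint_right.1 (hdisj l l' (hT l' hl').1) hp⟩, hp⟩
    · by_contra hne
      exact Finset.disjoint_left.1 (hdisj x y hne) hx.2 hy.2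
  have hadd := Finset.card_sdiff_add_card_eq_card hsub
  rw [Finset.card_product, Finset.card_univ] at hadd
  omega


/-- Serialization lemma: any qubit-disjoint layer of one- and two-qubit logical
operations can be partitioned into at most `2k - 1` block-disjoint sub-layers.
The partition is encoded as a coloring `f : L → Fin (2 * k - 1)`. -/
theorem stmt11
    {V : Type*} [Fintype V] [DecidableEq V]
    {L : Type*} [Fintype L] [DecidableEq L]
    (k : ℕ) (hk : 1 ≤ k)
    (qsupp : L → Finset (V × Fin k))
    (hne : ∀ l, (qsupp l).Nonempty)
    (hcard : ∀ l, (qsupp l).card ≤ 2)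
    (hdisj : ∀ l l', l ≠ l' → Disjoint (qsupp l) (qsupp l')) :
    ∃ f : L → Fin (2 * k - 1),
      ∀ l l', l ≠ l' → f l = f l' →
        Disjoint ((qsupp l).image Prod.fst) ((qsupp l').image Prod.fst) := by
  let G : SimpleGraph L :=
    { Adj := fun l l' ↦
        l ≠ l' ∧ ¬ Disjoint ((qsupp l).image Prod.fst) ((qsupp l').image Prod.fst)
      symm := ⟨fun _ _ h ↦ ⟨h.1.symm, fun hd ↦ h.2 hd.symm⟩⟩
      loopless := ⟨fun _ h ↦ h.1 rfl⟩ }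
  classical
  have hdeg : ∀ l, G.degree l < 2 * k - 1 := by
    intro l
    have hcount := card_add_card_le_of_not_disjoint_image_fst qsupp hdisj l (G.neighborFinset l)
      fun l' hl' ↦ (G.mem_neighborFinset l l').1 hl'
    rw [G.card_neighborFinset_eq_degree, Fintype.card_fin] at hcount
    have himage : ((qsupp l).image Prod.fst).card ≤ (qsupp l).card := Finset.card_image_le
    have hpos := (hne l).card_pos
    have hmul := Nat.mul_le_mul_right k (himage.trans (hcard l))
    obtain h | h : (qsupp l).card = 1 ∨ (qsupp l).card = 2 := by have := hcard l; omega
    · have hmul' := Nat.mul_le_mul_right k (himage.trans h.le)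
      omega
    · omega
  obtain ⟨f⟩ := G.colorable_of_degree_lt (by omega) hdeg
  exact ⟨f, fun l l' hll' hf ↦ by_contra fun hd ↦ f.valid (show G.Adj l l' from ⟨hll', hd⟩) hf⟩
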